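/- arXiv:1706.08022 — 2 statements merged into one kernel-verified Lean document; each statement's English description precedes it below -/
import Mathlib

section
/- Let Φ : ℂ → ℂ be an entire function with Taylor expansion Φ(z) = ∑_{n≥0} aₙ zⁿ which is of exponential type, i.e., there exist M, R > 0 with |aₙ| ≤ M·Rⁿ/n! for all n. Suppose that the level set {z ∈ ℂ : |Φ(z)| = 1} contains a non-trivial strictly convex compact arc Γ₁ satisfying conv(Γ₁ ∪ {0}) \ (Γ₁ ∪ {0}) ⊆ {z ∈ ℂ : |Φ(z)| < 1}. Then the set of entire functions f that generate a hypercyclic algebra for the convolution operator Φ(D) is residual (comeager) in H(ℂ). -/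
open Set Polynomial

noncomputable section

abbrev Entire : Type := {f : C(ℂ, ℂ) // Differentiable ℂ (⇑f)}

instance : Zero Entire := ⟨⟨0, by rw [ContinuousMap.coe_zero]; exact differentiable_const 0⟩⟩

def Hypercyclic {X : Type*} [TopologicalSpace X] (T : X → X) (x : X) : Prop :=
  Dense (Set.range fun n : ℕ => T^[n] x)

def polyApply (P : Polynomial ℂ) (f : Entire) : Entire :=
  ⟨⟨fun z => P.eval (f.1 z), by exact (P.differentiable.comp f.2).continuous⟩,
   by exact P.differentiable.comp f.2⟩

def GeneratesHCAlgebra (T : Entire → Entire) (f : Entire) : Prop :=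
  ∀ P : Polynomial ℂ, P.coeff 0 = 0 → polyApply P f ≠ 0 → Hypercyclic T (polyApply P f)

def ExpType (a : ℕ → ℂ) : Prop :=
  ∃ M > (0:ℝ), ∃ R > (0:ℝ), ∀ n : ℕ, ‖a n‖ ≤ M * R ^ n / n.factorial

def IsCompactArc (Γ : Set ℂ) : Prop :=
  ∃ γ : ℝ → ℂ, ContinuousOn γ (Icc 0 1) ∧ InjOn γ (Icc 0 1) ∧ Γ = γ '' Icc 0 1

def StrictlyConvexArc (Γ : Set ℂ) : Prop :=
  IsCompactArc Γ ∧
  ∀ z₁ ∈ Γ, ∀ z₂ ∈ Γ, ∀ u ∈ segment ℝ z₁ z₂ ∩ Γ, ∀ v ∈ segment ℝ z₁ z₂ ∩ Γ,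
    ∀ w ∈ segment ℝ z₁ z₂ ∩ Γ, u = v ∨ u = w ∨ v = w

/-! ### Planar geometry of the arc -/

lemma clm_apply_eq (f : ℂ →L[ℝ] ℝ) (z : ℂ) : f z = f 1 * z.re + f Complex.I * z.im := by
  have h : z = z.re • (1 : ℂ) + z.im • Complex.I := by
    apply Complex.ext <;> simp
  conv_lhs => rw [h]
  rw [map_add, map_smul, map_smul, smul_eq_mul, smul_eq_mul]
  ring

lemma collinear_of_clm_eq {f : ℂ →L[ℝ] ℝ} (hf : f ≠ 0) {x y z : ℂ} (hy : f y = f x)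
    (hz : f z = f x) : Collinear ℝ {x, y, z} := by
  have hn : f 1 ^ 2 + f Complex.I ^ 2 ≠ 0 := by
    intro h
    apply hf
    have h1 : f 1 = 0 := by nlinarith [sq_nonneg (f 1), sq_nonneg (f Complex.I)]
    have h2 : f Complex.I = 0 := by nlinarith [sq_nonneg (f 1), sq_nonneg (f Complex.I)]
    ext w
    rw [clm_apply_eq f w, h1, h2]
    simp
  rw [collinear_iff_of_mem (p₀ := x) (by simp)]
  refine ⟨⟨-f Complex.I, f 1⟩, fun p hp => ?_⟩
  have hp' : f p = f x := by
    simp only [mem_insert_iff, mem_singleton_iff] at hp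
    rcases hp with rfl | rfl | rfl <;> simp_all
  rw [clm_apply_eq f p, clm_apply_eq f x] at hp'
  refine ⟨((p.im - x.im) * f 1 - (p.re - x.re) * f Complex.I) / (f 1 ^ 2 + f Complex.I ^ 2), ?_⟩
  apply Complex.ext
  · simp only [vadd_eq_add, Complex.add_re, Complex.smul_re, smul_eq_mul]
    field_simp
    linear_combination (f 1) * hp'
  · simp only [vadd_eq_add, Complex.add_im, Complex.smul_im, smul_eq_mul]
    field_simp
    linear_combination (f Complex.I) * hp'

lemma StrictlyConvexArc.not_collinear {Γ : Set ℂ} (h : StrictlyConvexArc Γ) {x y z : ℂ}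
    (hx : x ∈ Γ) (hy : y ∈ Γ) (hz : z ∈ Γ) (hxy : x ≠ y) (hxz : x ≠ z) (hyz : y ≠ z) :
    ¬ Collinear ℝ {x, y, z} := by
  have key : ∀ {a b c : ℂ}, a ∈ Γ → b ∈ Γ → c ∈ Γ → Wbtw ℝ a b c →
      a = b ∨ a = c ∨ b = c := fun ha hb hc hw =>
    h.2 _ ha _ hc _ ⟨left_mem_segment ℝ _ _, ha⟩ _ ⟨mem_segment_iff_wbtw.2 hw, hb⟩
      _ ⟨right_mem_segment ℝ _ _, hc⟩
  intro hcol
  rcases hcol.wbtw_or_wbtw_or_wbtw with hw | hw | hw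
  · rcases key hx hy hz hw with h | h | h <;> contradiction
  · rcases key hy hz hx hw with h | h | h <;> simp_all
  · rcases key hz hx hy hw with h | h | h <;> simp_all

lemma StrictlyConvexArc.isPreconnected {Γ : Set ℂ} (h : StrictlyConvexArc Γ) :
    IsPreconnected Γ := by
  obtain ⟨γ, hc, -, rfl⟩ := h.1
  exact isPreconnected_Icc.image γ hc

lemma StrictlyConvexArc.infinite {Γ : Set ℂ} (h : StrictlyConvexArc Γ) (hnt : Γ.Nontrivial) :
    Γ.Infinite :=
  h.isPreconnected.infinite_of_nontrivial hnt

lemma StrictlyConvexArc.finite_inter_line {Γ : Set ℂ} (h : StrictlyConvexArc Γ)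
    {f : ℂ →L[ℝ] ℝ} (hf : f ≠ 0) (c : ℝ) : {z ∈ Γ | f z = c}.Finite := by
  by_contra hinf
  obtain ⟨t, ht, hcard⟩ := Set.Infinite.exists_subset_card_eq hinf 3
  obtain ⟨x, y, z, hxy, hxz, hyz, rfl⟩ := Finset.card_eq_three.1 hcard
  have hx := ht (show x ∈ _ by simp)
  have hy := ht (show y ∈ _ by simp)
  have hz := ht (show z ∈ _ by simp)
  exact h.not_collinear hx.1 hy.1 hz.1 hxy hxz hyz
    (collinear_of_clm_eq hf (hy.2.trans hx.2.symm) (hz.2.trans hx.2.symm))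

/-- The functional `z ↦ det (w, z)`, whose kernel is the real line spanned by `w`. -/
def detCLM (w : ℂ) : ℂ →L[ℝ] ℝ := w.re • Complex.imCLM - w.im • Complex.reCLM

lemma detCLM_apply (w z : ℂ) : detCLM w z = w.re * z.im - w.im * z.re := by
  simp [detCLM]

lemma detCLM_ne_zero {w : ℂ} (hw : w ≠ 0) : detCLM w ≠ 0 := by
  intro h
  have h1 : detCLM w 1 = 0 := by rw [h]; rfl
  have h2 : detCLM w Complex.I = 0 := by rw [h]; rfl
  rw [detCLM_apply] at h1 h2
  apply hw
  apply Complex.ext <;> simp_all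

lemma exists_support {K : Set ℂ} (hK : Convex ℝ K) (hne : (interior K).Nonempty) {x : ℂ}
    (hx : x ∉ interior K) :
    ∃ f : ℂ →L[ℝ] ℝ, f ≠ 0 ∧ (∀ y ∈ interior K, f y < f x) ∧ ∀ y ∈ K, f y ≤ f x := by
  obtain ⟨f, hf⟩ := geometric_hahn_banach_open_point hK.interior isOpen_interior hx
  refine ⟨f, ?_, hf, fun y hy => ?_⟩
  · rintro rfl
    obtain ⟨y, hy⟩ := hne
    simpa using hf y hy
  · have hy' : y ∈ closure (interior K) := by
      rw [hK.closure_interior_eq_closure_of_nonempty_interior hne]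
      exact subset_closure hy
    have hcl : IsClosed {z | f z ≤ f x} := isClosed_le f.continuous continuous_const
    exact closure_minimal (fun z hz => (hf z hz).le) hcl hy'

lemma StrictlyConvexArc.interior_nonempty {Γ : Set ℂ} (h : StrictlyConvexArc Γ)
    (hnt : Γ.Nontrivial) : (interior (convexHull ℝ (Γ ∪ {0}))).Nonempty := by
  rw [interior_convexHull_nonempty_iff_affineSpan_eq_top]
  obtain ⟨t, ht, hcard⟩ := (h.infinite hnt).exists_subset_card_eq 3
  obtain ⟨x, y, z, hxy, hxz, hyz, rfl⟩ := Finset.card_eq_three.1 hcard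
  have hnc := h.not_collinear (ht (show x ∈ _ by simp)) (ht (show y ∈ _ by simp))
    (ht (show z ∈ _ by simp)) hxy hxz hyz
  have hsub : ({x, y, z} : Set ℂ) ⊆ Γ ∪ {0} := by
    intro w hw
    exact Or.inl (ht (by simpa using hw))
  rw [AffineSubspace.affineSpan_eq_top_iff_vectorSpan_eq_top_of_nonempty (k := ℝ) (V := ℂ) (P := ℂ)
    (s := Γ ∪ {0}) ⟨0, Or.inr rfl⟩]
  rw [collinear_iff_finrank_le_one, not_le] at hnc
  have h2 : vectorSpan ℝ ({x, y, z} : Set ℂ) = ⊤ := by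
    apply Submodule.eq_top_of_finrank_eq
    have := Submodule.finrank_le (vectorSpan ℝ ({x, y, z} : Set ℂ))
    rw [Complex.finrank_real_complex] at *
    omega
  exact top_le_iff.1 (h2 ▸ vectorSpan_mono ℝ hsub)

lemma StrictlyConvexArc.exists_half_mem_interior {Γ : Set ℂ} (h : StrictlyConvexArc Γ)
    (hnt : Γ.Nontrivial) :
    ∃ p ∈ Γ, p ≠ 0 ∧ (1 / 2 : ℝ) • p ∈ interior (convexHull ℝ (Γ ∪ {0})) := by
  set K := convexHull ℝ (Γ ∪ {0}) with hKdef
  have hK : Convex ℝ K := convex_convexHull ℝ _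
  have hsub : Γ ∪ {0} ⊆ K := subset_convexHull ℝ _
  by_contra! hcon
  have hside : ∀ a ∈ Γ, a ≠ 0 → ∀ b ∈ Γ, ∀ c ∈ Γ, 0 ≤ detCLM a b * detCLM a c := by
    intro a ha ha0 b hb c hc
    obtain ⟨f, hf0, -, hf⟩ := exists_support hK (h.interior_nonempty hnt) (hcon a ha ha0)
    have h0 := hf 0 (hsub (Or.inr rfl))
    have h1 := hf a (hsub (Or.inl ha))
    have h2 := hf b (hsub (Or.inl hb))
    have h3 := hf c (hsub (Or.inl hc))
    rw [map_smul, smul_eq_mul] at h0 h1 h2 h3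
    rw [map_zero] at h0
    have hfa : f a = 0 := by linarith
    rw [hfa, mul_zero] at h2 h3
    rw [clm_apply_eq] at hfa h2 h3
    have hn : 0 < a.re ^ 2 + a.im ^ 2 := by
      rcases (Complex.ext_iff.not.1 ha0 |> not_and_or.1) with h | h
      · have := sq_pos_of_ne_zero (a := a.re) h; positivity
      · have := sq_pos_of_ne_zero (a := a.im) h; positivity
    obtain ⟨k, hk1, hk2⟩ : ∃ k : ℝ, f 1 = -k * a.im ∧ f Complex.I = k * a.re := by
      refine ⟨(f Complex.I * a.re - f 1 * a.im) / (a.re ^ 2 + a.im ^ 2), ?_, ?_⟩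
      · field_simp
        linear_combination a.re * hfa
      · field_simp
        linear_combination a.im * hfa
    have hk : k ≠ 0 := by
      rintro rfl
      apply hf0
      ext w
      rw [clm_apply_eq, hk1, hk2]
      simp
    rw [hk1, hk2] at h2 h3
    have h2' : k * detCLM a b ≤ 0 := by rw [detCLM_apply]; linarith
    have h3' : k * detCLM a c ≤ 0 := by rw [detCLM_apply]; linarith
    have := mul_nonneg_of_nonpos_of_nonpos h2' h3'
    have hk2 : 0 < k ^ 2 := by positivity
    by_contra! hneg
    nlinarith
  have hinf := h.infinite hnt
  obtain ⟨a, ha, ha0⟩ := (hinf.sdiff (finite_singleton (0 : ℂ))).nonempty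
  obtain ⟨b, hb, hb0⟩ := (hinf.sdiff (h.finite_inter_line (detCLM_ne_zero ha0) 0)).nonempty
  have hab : detCLM a b ≠ 0 := fun h => hb0 ⟨hb, h⟩
  have hbne : b ≠ 0 := by rintro rfl; simp at hab
  obtain ⟨c, hc, hc0⟩ := (hinf.sdiff ((h.finite_inter_line (detCLM_ne_zero ha0) 0).union
    (h.finite_inter_line (detCLM_ne_zero hbne) 0))).nonempty
  have hac : detCLM a c ≠ 0 := fun h => hc0 (Or.inl ⟨hc, h⟩)
  have hbc : detCLM b c ≠ 0 := fun h => hc0 (Or.inr ⟨hc, h⟩)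
  have hcne : c ≠ 0 := by rintro rfl; simp at hac
  have e1 := hside a ha ha0 b hb c hc
  have e2 := hside b hb hbne a ha c hc
  have e3 := hside c hc hcne a ha b hb
  have s1 : detCLM b a = -detCLM a b := by simp only [detCLM_apply]; ring
  have s2 : detCLM c a = -detCLM a c := by simp only [detCLM_apply]; ring
  have s3 : detCLM c b = -detCLM b c := by simp only [detCLM_apply]; ring
  rw [s1] at e2
  rw [s2, s3] at e3
  have hpos : 0 < (detCLM a b * detCLM a c * detCLM b c) ^ 2 := by positivity
  nlinarith [mul_nonneg (mul_nonneg e1 e2) e3]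

/-- A sum of at most `m` points of `S ∪ {0}`, divided by `m`, lies in the convex hull of the arc
and `0`, off the arc and `0`, unless it is trivially one of these points. -/
lemma StrictlyConvexArc.average_mem {Γ : Set ℂ} (h : StrictlyConvexArc Γ) (hnt : Γ.Nontrivial)
    {m j : ℕ} (hjm : j ≤ m)
    (y : Fin j → ℂ)
    (hy : ∀ i, y i = 0 ∨ y i ∈ Γ ∧ (1 / 2 : ℝ) • y i ∈ interior (convexHull ℝ (Γ ∪ {0})))
    (hy0 : ∃ i, y i ∈ Γ ∧ (1 / 2 : ℝ) • y i ∈ interior (convexHull ℝ (Γ ∪ {0})))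
    (hmix : j < m ∨ (∃ i, y i = 0) ∨ ∃ i k, y i ≠ y k) :
    (m : ℝ)⁻¹ • ∑ i, y i ∈ interior (convexHull ℝ (Γ ∪ {0})) ∪
      (convexHull ℝ (Γ ∪ {0}) \ (Γ ∪ {0})) := by
  set K := convexHull ℝ (Γ ∪ {0}) with hKdef
  have hK : Convex ℝ K := convex_convexHull ℝ _
  have hsub : Γ ∪ {0} ⊆ K := subset_convexHull ℝ _
  obtain ⟨i₀, hi₀, hi₀'⟩ := hy0
  have hj : 0 < j := i₀.pos
  have hm : (0 : ℝ) < m := by exact_mod_cast hj.trans_le hjm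
  have hjm' : (j : ℝ) ≤ m := by exact_mod_cast hjm
  have hyK : ∀ i, y i ∈ K := fun i => by
    rcases hy i with h | h
    · exact hsub (Or.inr h)
    · exact hsub (Or.inl h.1)
  by_cases hx : (m : ℝ)⁻¹ • ∑ i, y i ∈ interior K
  · exact Or.inl hx
  right
  obtain ⟨f, hf0, hfint, hf⟩ := exists_support hK (h.interior_nonempty hnt) hx
  set x := (m : ℝ)⁻¹ • ∑ i, y i with hxdef
  have hfx : (m : ℝ) * f x = ∑ i, f (y i) := by
    rw [hxdef, map_smul, map_sum, smul_eq_mul, mul_inv_cancel_left₀ hm.ne']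
  have h0 : 0 ≤ f x := by simpa using hf 0 (hsub (Or.inr rfl))
  have hle : ∀ i ∈ Finset.univ, f (y i) ≤ f x := fun i _ => hf _ (hyK i)
  have hpos : 0 < f x := by
    refine lt_of_le_of_ne h0 fun h0' => ?_
    have hlt := hfint _ hi₀'
    rw [map_smul, smul_eq_mul] at hlt
    have : ∑ i, f (y i) < ∑ _i : Fin j, f x :=
      Finset.sum_lt_sum hle ⟨i₀, Finset.mem_univ _, by linarith⟩
    rw [← hfx, ← h0'] at this
    simp at this
  have hcard : ∑ _i : Fin j, f x = j * f x := by simp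
  have hjeq : j = m := by
    refine le_antisymm hjm (not_lt.1 fun hlt => ?_)
    have h1 := Finset.sum_le_sum hle
    rw [← hfx, hcard] at h1
    have : (j : ℝ) < m := by exact_mod_cast hlt
    nlinarith
  subst hjeq
  have heq : ∀ i, f (y i) = f x := by
    by_contra! hne
    obtain ⟨i, hi⟩ := hne
    have : ∑ i, f (y i) < ∑ _i : Fin j, f x :=
      Finset.sum_lt_sum hle ⟨i, Finset.mem_univ _, lt_of_le_of_ne (hle i (Finset.mem_univ _)) hi⟩
    rw [← hfx, hcard] at this
    exact lt_irrefl _ this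
  have hne0 : ∀ i, y i ≠ 0 := fun i hi => by
    have := heq i
    rw [hi, map_zero] at this
    exact hpos.ne this
  have hyΓ : ∀ i, y i ∈ Γ := fun i => ((hy i).resolve_left (hne0 i)).1
  have hxK : x ∈ K := by
    rw [hxdef, Finset.smul_sum]
    refine hK.sum_mem (fun _ _ => by positivity) ?_ fun i _ => hyK i
    simp [hm.ne']
  refine ⟨hxK, ?_⟩
  rintro (hxΓ | hx0)
  · obtain ⟨a, b, hab⟩ : ∃ i k, y i ≠ y k := by
      rcases hmix with h | ⟨i, hi⟩ | h
      · exact absurd h (lt_irrefl _)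
      · exact absurd hi (hne0 i)
      · exact h
    obtain ⟨v, hvx, hv⟩ : ∃ v, v ≠ x ∧ ∀ i, y i = x ∨ y i = v := by
      obtain ⟨c, hc⟩ : ∃ c, y c ≠ x := by
        by_cases h : y a = x
        · exact ⟨b, fun h' => hab (h.trans h'.symm)⟩
        · exact ⟨a, h⟩
      refine ⟨y c, hc, fun i => ?_⟩
      by_contra! hi
      exact h.not_collinear hxΓ (hyΓ i) (hyΓ c) hi.1.symm hc.symm hi.2
        (collinear_of_clm_eq hf0 (heq i) (heq c))
    have hsum : ∑ i, (y i - x) = 0 := by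
      rw [Finset.sum_sub_distrib]
      have : ∑ i, y i = (j : ℝ) • x := by rw [hxdef, smul_inv_smul₀ hm.ne']
      rw [this]
      simp
    have hterm : ∀ i, y i - x = (if y i = x then (0 : ℂ) else 1) * (v - x) := fun i => by
      rcases hv i with h | h
      · simp [h]
      · simp [h, hvx]
    simp_rw [hterm] at hsum
    rw [← Finset.sum_mul, mul_eq_zero, sub_eq_zero, or_iff_left hvx] at hsum
    have hall : ∀ i, y i = x := by
      have hr : ∑ i, (if y i = x then (0 : ℝ) else 1) = 0 := by
        have := congrArg Complex.re hsum
        rw [Complex.re_sum] at this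
        simpa [apply_ite Complex.re] using this
      intro i
      rw [Finset.sum_eq_zero_iff_of_nonneg (fun i _ => by split_ifs <;> norm_num)] at hr
      have := hr i (Finset.mem_univ _)
      by_contra hi
      simp [hi] at this
    exact hab ((hall a).trans (hall b).symm)
  · rw [mem_singleton_iff] at hx0
    rw [hx0, map_zero] at hpos
    exact lt_irrefl _ hpos

/-! ### The modulus of the symbol on the convex hull -/

lemma StrictlyConvexArc.exists_hull_not_mem {Γ : Set ℂ} (h : StrictlyConvexArc Γ)
    (hnt : Γ.Nontrivial) : ∃ z, z ∈ convexHull ℝ (Γ ∪ {0}) \ (Γ ∪ {0}) := by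
  obtain ⟨x, hx, y, hy, hxy⟩ := hnt
  have key : ∀ t : ℝ, 0 < t → t < 1 → AffineMap.lineMap x y t ≠ (0 : ℂ) →
      AffineMap.lineMap x y t ∈ convexHull ℝ (Γ ∪ {0}) \ (Γ ∪ {0}) := by
    intro t ht0 ht1 hne
    have hw : Sbtw ℝ x (AffineMap.lineMap x y t) y := sbtw_lineMap_iff.2 ⟨hxy, ht0, ht1⟩
    have hseg := mem_segment_iff_wbtw.2 hw.wbtw
    have hx' : x ∈ Γ ∪ {0} := Or.inl hx
    have hy' : y ∈ Γ ∪ {0} := Or.inl hy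
    refine ⟨segment_subset_convexHull hx' hy' hseg, ?_⟩
    rintro (hΓ | h0)
    · rcases h.2 x hx y hy x ⟨left_mem_segment ℝ _ _, hx⟩ _ ⟨hseg, hΓ⟩ y
        ⟨right_mem_segment ℝ _ _, hy⟩ with h | h | h
      · exact hw.ne_left h.symm
      · exact hxy h
      · exact hw.ne_right h
    · exact hne h0
  by_cases h0 : AffineMap.lineMap x y (1 / 2 : ℝ) = (0 : ℂ)
  · refine ⟨_, key (1 / 3) (by norm_num) (by norm_num) fun h1 => ?_⟩
    have := AffineMap.lineMap_injective ℝ hxy (h0.trans h1.symm)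
    norm_num at this
  · exact ⟨_, key _ (by norm_num) (by norm_num) h0⟩

lemma not_isLocalMax_norm {Φ : ℂ → ℂ} (hΦ : Differentiable ℂ Φ) {w z : ℂ}
    (hw : ‖Φ w‖ ≠ ‖Φ z‖) : ¬ IsLocalMax (norm ∘ Φ) z := by
  intro hmax
  have hev : ∀ᶠ y in nhds z, Φ y = Φ z :=
    Complex.eventually_eq_of_isLocalMax_norm (Filter.Eventually.of_forall fun y => hΦ y) hmax
  have han : AnalyticOnNhd ℂ Φ univ := fun y _ => hΦ.analyticAt y
  have := han.eqOn_of_preconnected_of_eventuallyEq (g := fun _ => Φ z)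
    (fun y _ => analyticAt_const) isPreconnected_univ (mem_univ z) hev (mem_univ w)
  exact hw (by rw [this])

lemma norm_lt_one_of_mem_interior {Φ : ℂ → ℂ} (hΦ : Differentiable ℂ Φ) {Γ : Set ℂ}
    (h : StrictlyConvexArc Γ) (hnt : Γ.Nontrivial) (hlev : ∀ z ∈ Γ, ‖Φ z‖ = 1)
    (hhull : convexHull ℝ (Γ ∪ {0}) \ (Γ ∪ {0}) ⊆ {z : ℂ | ‖Φ z‖ < 1}) {z : ℂ}
    (hz : z ∈ interior (convexHull ℝ (Γ ∪ {0}))) : ‖Φ z‖ < 1 := by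
  set K := convexHull ℝ (Γ ∪ {0}) with hKdef
  have hK : Convex ℝ K := convex_convexHull ℝ _
  have hsub : Γ ∪ {0} ⊆ K := subset_convexHull ℝ _
  have hle' : ∀ y ∈ K, y ≠ 0 → ‖Φ y‖ ≤ 1 := by
    intro y hy hy0
    by_cases hyΓ : y ∈ Γ
    · exact (hlev y hyΓ).le
    · exact (hhull ⟨hy, by rintro (h | h); exacts [hyΓ h, hy0 h]⟩ : ‖Φ y‖ < 1).le
  have hle : ∀ y ∈ K, ‖Φ y‖ ≤ 1 := by
    intro y hy
    by_cases hy0 : y = 0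
    · subst hy0
      obtain ⟨p, hp, hp0, -⟩ := h.exists_half_mem_interior hnt
      have htend : Filter.Tendsto (fun t : ℝ => ‖Φ (t • p)‖) (nhdsWithin 0 (Ioi 0))
          (nhds ‖Φ 0‖) := by
        have : Continuous fun t : ℝ => ‖Φ (t • p)‖ :=
          (hΦ.continuous.comp (continuous_id.smul continuous_const)).norm
        have h2 := this.tendsto 0
        rw [zero_smul] at h2
        exact h2.mono_left nhdsWithin_le_nhds
      refine le_of_tendsto htend ?_
      filter_upwards [Ioo_mem_nhdsGT (zero_lt_one (α := ℝ))] with t ht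
      exact hle' _ (hK.smul_mem_of_zero_mem hy (hsub (Or.inl hp)) ⟨ht.1.le, ht.2.le⟩)
        (smul_ne_zero ht.1.ne' hp0)
    · exact hle' y hy hy0
  obtain ⟨w, hw⟩ := h.exists_hull_not_mem hnt
  have hw1 : ‖Φ w‖ < 1 := hhull hw
  refine lt_of_le_of_ne (hle z (interior_subset hz)) fun h1 => ?_
  refine not_isLocalMax_norm hΦ (h1 ▸ hw1.ne) ?_
  filter_upwards [isOpen_interior.mem_nhds hz] with y hy
  simpa [h1] using hle y (interior_subset hy)

lemma mem_closure_one_lt_norm {Φ : ℂ → ℂ} (hΦ : Differentiable ℂ Φ) {w z : ℂ}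
    (hw : ‖Φ w‖ < 1) (hz : ‖Φ z‖ = 1) : z ∈ closure {y | 1 < ‖Φ y‖} := by
  by_contra hcl
  refine not_isLocalMax_norm hΦ (hz ▸ hw.ne) ?_
  filter_upwards [isClosed_closure.isOpen_compl.mem_nhds hcl] with y hy
  have : ¬ 1 < ‖Φ y‖ := fun h => hy (subset_closure h)
  simpa [hz] using this

/-- The points of the arc at which exponentials approximating the target are placed. -/
def innerArc (Γ : Set ℂ) : Set ℂ :=
  {z ∈ Γ | (1 / 2 : ℝ) • z ∈ interior (convexHull ℝ (Γ ∪ {0}))}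

lemma StrictlyConvexArc.exists_accPt {Γ : Set ℂ} (h : StrictlyConvexArc Γ)
    (hnt : Γ.Nontrivial) :
    ∃ p ∈ innerArc Γ, p ≠ 0 ∧ AccPt p (Filter.principal (innerArc Γ)) := by
  obtain ⟨p, hp, hp0, hpK⟩ := h.exists_half_mem_interior hnt
  refine ⟨p, ⟨hp, hpK⟩, hp0, ?_⟩
  have hacc : AccPt p (Filter.principal Γ) := h.isPreconnected.preperfect_of_nontrivial hnt p hp
  have hopen : {z : ℂ | (1 / 2 : ℝ) • z ∈ interior (convexHull ℝ (Γ ∪ {0}))} ∈ nhds p :=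
    (isOpen_interior.preimage (continuous_const_smul (1 / 2 : ℝ))).mem_nhds hpK
  have := hacc.nhds_inter hopen
  rwa [inter_comm] at this

lemma smul_mem_interior {K : Set ℂ} (hK : Convex ℝ K) (h0 : (0 : ℂ) ∈ K) {p : ℂ} (hp : p ∈ K)
    (hp2 : (1 / 2 : ℝ) • p ∈ interior K) {t : ℝ} (ht0 : 0 < t) (ht1 : t < 1) :
    t • p ∈ interior K := by
  rcases le_total t (1 / 2) with ht | ht
  · have := hK.add_smul_sub_mem_interior h0 hp2 (t := 2 * t) ⟨by linarith, by linarith⟩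
    rw [sub_zero, zero_add, smul_smul] at this
    convert this using 2
    ring
  · have := hK.add_smul_sub_mem_interior hp hp2 (t := 2 * (1 - t)) ⟨by linarith, by linarith⟩
    convert this using 1
    module

lemma StrictlyConvexArc.norm_average_lt_one {Φ : ℂ → ℂ} (hΦ : Differentiable ℂ Φ) {Γ : Set ℂ}
    (h : StrictlyConvexArc Γ) (hnt : Γ.Nontrivial) (hlev : ∀ z ∈ Γ, ‖Φ z‖ = 1)
    (hhull : convexHull ℝ (Γ ∪ {0}) \ (Γ ∪ {0}) ⊆ {z : ℂ | ‖Φ z‖ < 1}) {m j : ℕ}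
    (hjm : j ≤ m) (y : Fin j → ℂ) (hy : ∀ i, y i = 0 ∨ y i ∈ innerArc Γ)
    (hy0 : ∃ i, y i ∈ innerArc Γ) (hmix : j < m ∨ (∃ i, y i = 0) ∨ ∃ i k, y i ≠ y k) :
    ‖Φ ((m : ℝ)⁻¹ • ∑ i, y i)‖ < 1 := by
  rcases h.average_mem hnt hjm y hy hy0 hmix with h' | h'
  · exact norm_lt_one_of_mem_interior hΦ h hnt hlev hhull h'
  · exact hhull h'

/-! ### Exponentials are total in the space of entire functions -/

/-- The exponential `z ↦ exp (ν * z)` as a continuous map. -/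
def expMap (ν : ℂ) : C(ℂ, ℂ) := ⟨fun z => Complex.exp (ν * z), by fun_prop⟩

lemma expMap_apply (ν z : ℂ) : expMap ν z = Complex.exp (ν * z) := rfl

lemma differentiable_expMap (ν : ℂ) : Differentiable ℂ (expMap ν) := by
  change Differentiable ℂ fun z => Complex.exp (ν * z)
  fun_prop

lemma continuous_expMap : Continuous expMap :=
  (ContinuousMap.curry (⟨fun p : ℂ × ℂ => Complex.exp (p.1 * p.2), by fun_prop⟩ :
    C(ℂ × ℂ, ℂ))).continuous

lemma prod_expMap {ι : Type*} (s : Finset ι) (ν : ι → ℂ) :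
    ∏ i ∈ s, expMap (ν i) = expMap (∑ i ∈ s, ν i) := by
  ext z
  simp [ContinuousMap.prod_apply, expMap_apply, Finset.sum_mul, Complex.exp_sum]

lemma tendsto_of_norm_sub_le {ι : Type*} {l : Filter ι} {F : ι → C(ℂ, ℂ)} {f : C(ℂ, ℂ)}
    (b : ℝ → ι → ℝ) (hb : ∀ r, 0 < r → Filter.Tendsto (b r) l (nhds 0))
    (hF : ∀ r, 0 < r → ∀ᶠ i in l, ∀ z, ‖z‖ ≤ r → ‖F i z - f z‖ ≤ b r i) :
    Filter.Tendsto F l (nhds f) := by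
  rw [ContinuousMap.tendsto_iff_forall_isCompact_tendstoUniformlyOn]
  intro K hK
  obtain ⟨r, hr, hKr⟩ : ∃ r, 0 < r ∧ ∀ z ∈ K, ‖z‖ ≤ r := by
    obtain ⟨r, hr⟩ := hK.isBounded.exists_norm_le
    exact ⟨max r 1, by positivity, fun z hz => (hr z hz).trans (le_max_left _ _)⟩
  rw [Metric.tendstoUniformlyOn_iff]
  intro ε hε
  filter_upwards [hF r hr, (hb r hr).eventually (gt_mem_nhds hε)] with i hi hbi z hz
  rw [dist_comm, dist_eq_norm]
  exact (hi z (hKr z hz)).trans_lt hbi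

/-- The function `z ↦ z ^ k * exp (ν * z)`. -/
def monoExp (ν : ℂ) (k : ℕ) : C(ℂ, ℂ) := (ContinuousMap.id ℂ) ^ k * expMap ν

lemma monoExp_apply (ν : ℂ) (k : ℕ) (z : ℂ) : monoExp ν k z = z ^ k * Complex.exp (ν * z) := rfl

lemma tendsto_exp_divided_difference (ν : ℂ) (k : ℕ) (s : Set ℂ) :
    Filter.Tendsto
      (fun w : ℂ => ((w - ν) ^ k)⁻¹ • (expMap w - ∑ i ∈ Finset.range k,
        ((w - ν) ^ i / (i.factorial : ℂ)) • monoExp ν i))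
      (nhdsWithin ν (s \ {ν})) (nhds ((k.factorial : ℂ)⁻¹ • monoExp ν k)) := by
  refine tendsto_of_norm_sub_le
    (fun r w => ‖w - ν‖ * (r ^ (k + 1) * (Real.exp r * Real.exp (‖ν‖ * r)))) (fun r hr => ?_)
    fun r hr => ?_
  · have h : Continuous fun w : ℂ =>
        ‖w - ν‖ * (r ^ (k + 1) * (Real.exp r * Real.exp (‖ν‖ * r))) := by fun_prop
    have h' := h.tendsto ν
    simp only [sub_self, norm_zero, zero_mul] at h'
    exact h'.mono_left nhdsWithin_le_nhds
  · have hnear : ∀ᶠ w in nhdsWithin ν (s \ {ν}), ‖w - ν‖ < 1 := by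
      have := Metric.ball_mem_nhds ν one_pos
      filter_upwards [nhdsWithin_le_nhds this] with w hw
      rwa [← dist_eq_norm]
    filter_upwards [hnear, self_mem_nhdsWithin] with w hw1 hw2 z hz
    have hδ : w - ν ≠ 0 := sub_ne_zero.2 hw2.2
    have hexp : Complex.exp (w * z) = Complex.exp (ν * z) * Complex.exp ((w - ν) * z) := by
      rw [← Complex.exp_add]
      congr 1
      ring
    have hid : (((w - ν) ^ k)⁻¹ • (expMap w - ∑ i ∈ Finset.range k,
        ((w - ν) ^ i / (i.factorial : ℂ)) • monoExp ν i)) z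
        - ((k.factorial : ℂ)⁻¹ • monoExp ν k) z
        = ((w - ν) ^ k)⁻¹ * (Complex.exp (ν * z) * (Complex.exp ((w - ν) * z) -
          ∑ i ∈ Finset.range (k + 1), ((w - ν) * z) ^ i / (i.factorial : ℂ))) := by
      simp only [ContinuousMap.smul_apply, ContinuousMap.sub_apply, ContinuousMap.sum_apply,
        smul_eq_mul, expMap_apply, monoExp_apply, hexp]
      have hsum : ∑ i ∈ Finset.range k, (w - ν) ^ i / (i.factorial : ℂ) *
          (z ^ i * Complex.exp (ν * z)) =
          Complex.exp (ν * z) * ∑ i ∈ Finset.range k, ((w - ν) * z) ^ i / (i.factorial : ℂ) := by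
        rw [Finset.mul_sum]
        refine Finset.sum_congr rfl fun i _ => ?_
        rw [mul_pow]
        ring
      rw [hsum, Finset.sum_range_succ, mul_pow]
      have hk : (w - ν) ^ k ≠ 0 := pow_ne_zero _ hδ
      field_simp
      ring
    rw [hid, norm_mul, norm_mul, norm_inv, norm_pow]
    have hδ' : 0 < ‖w - ν‖ := norm_pos_iff.2 hδ
    have hwz : ‖(w - ν) * z‖ ≤ r := by
      rw [norm_mul]
      nlinarith [norm_nonneg z]
    have h1 : ‖Complex.exp ((w - ν) * z) - ∑ i ∈ Finset.range (k + 1),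
        ((w - ν) * z) ^ i / (i.factorial : ℂ)‖ ≤ (‖w - ν‖ * r) ^ (k + 1) * Real.exp r := by
      refine (Complex.norm_exp_sub_sum_le_norm_mul_exp _ _).trans ?_
      have : ‖(w - ν) * z‖ ≤ ‖w - ν‖ * r := by
        rw [norm_mul]
        gcongr
      gcongr
    have h2 : ‖Complex.exp (ν * z)‖ ≤ Real.exp (‖ν‖ * r) := by
      refine (Complex.norm_exp_le_exp_norm _).trans ?_
      rw [norm_mul]
      gcongr
    calc _ ≤ (‖w - ν‖ ^ k)⁻¹ * (Real.exp (‖ν‖ * r) *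
          ((‖w - ν‖ * r) ^ (k + 1) * Real.exp r)) := by gcongr
      _ = ‖w - ν‖ * (r ^ (k + 1) * (Real.exp r * Real.exp (‖ν‖ * r))) := by
        rw [mul_pow, pow_succ ‖w - ν‖]
        field_simp

lemma monoExp_mem_closure_span {S : Set ℂ} {ν : ℂ} (hν : AccPt ν (Filter.principal S)) (k : ℕ) :
    monoExp ν k ∈ (Submodule.span ℂ (expMap '' S)).topologicalClosure := by
  induction k using Nat.strong_induction_on with
  | _ k ih =>
    have : (nhdsWithin ν (S \ {ν})).NeBot := accPt_principal_iff_nhdsWithin.1 hν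
    have hmem : (k.factorial : ℂ)⁻¹ • monoExp ν k ∈
        (Submodule.span ℂ (expMap '' S)).topologicalClosure := by
      refine (Submodule.isClosed_topologicalClosure _).mem_of_tendsto
        (tendsto_exp_divided_difference ν k S) ?_
      filter_upwards [self_mem_nhdsWithin] with w hw
      refine Submodule.smul_mem _ _ (Submodule.sub_mem _ ?_ (Submodule.sum_mem _ fun i hi => ?_))
      · exact Submodule.le_topologicalClosure _ (Submodule.subset_span ⟨w, hw.1, rfl⟩)
      · exact Submodule.smul_mem _ _ (ih i (Finset.mem_range.1 hi))
    have hk : (k.factorial : ℂ) ≠ 0 := by exact_mod_cast k.factorial_ne_zero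
    simpa [smul_smul, hk] using Submodule.smul_mem _ (k.factorial : ℂ) hmem

lemma exists_tendsto_sum_monomials {g : C(ℂ, ℂ)} (hg : Differentiable ℂ g) :
    ∃ c : ℕ → ℂ, Filter.Tendsto
      (fun n => ∑ i ∈ Finset.range n, c i • (ContinuousMap.id ℂ) ^ i) Filter.atTop (nhds g) := by
  have hps := hg.hasFPowerSeriesOnBall 0 (R := 1) one_pos
  refine ⟨(cauchyPowerSeries g 0 ((1 : NNReal) : ℝ)).coeff, ?_⟩
  rw [ContinuousMap.tendsto_iff_forall_isCompact_tendstoUniformlyOn]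
  intro K hK
  obtain ⟨r, hr⟩ := hK.isBounded.subset_ball 0
  have hr' : K ⊆ Metric.ball 0 ((Real.toNNReal r : NNReal) : ℝ) :=
    hr.trans (Metric.ball_subset_ball (Real.le_coe_toNNReal r))
  have := (hps.tendstoUniformlyOn (r' := Real.toNNReal r) (by simp)).mono hr'
  simp only [zero_add] at this
  refine this.congr (Filter.Eventually.of_forall fun n z _ => ?_)
  simp only [FormalMultilinearSeries.partialSum, ContinuousMap.sum_apply,
    ContinuousMap.smul_apply, ContinuousMap.pow_apply, ContinuousMap.id_apply]
  refine Finset.sum_congr rfl fun i _ => ?_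
  rw [FormalMultilinearSeries.apply_eq_pow_smul_coeff, smul_eq_mul, smul_eq_mul, mul_comm]

lemma mem_closure_span_expMap {S : Set ℂ} {ν : ℂ} (hν : AccPt ν (Filter.principal S))
    {f : C(ℂ, ℂ)} (hf : Differentiable ℂ f) :
    f ∈ (Submodule.span ℂ (expMap '' S)).topologicalClosure := by
  obtain ⟨c, hc⟩ := exists_tendsto_sum_monomials (g := f * expMap (-ν))
    (hf.mul (differentiable_expMap _))
  have hc' := hc.mul_const (expMap ν)
  have hfe : f * expMap (-ν) * expMap ν = f := by
    ext z
    simp [expMap_apply, mul_assoc, ← Complex.exp_add]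
  rw [hfe] at hc'
  refine (Submodule.isClosed_topologicalClosure _).mem_of_tendsto hc'
    (Filter.Eventually.of_forall fun n => ?_)
  rw [Finset.sum_mul]
  refine Submodule.sum_mem _ fun i _ => ?_
  rw [smul_mul_assoc]
  exact Submodule.smul_mem _ _ (monoExp_mem_closure_span hν i)

lemma exists_exp_sum_mem {S : Set ℂ} {ν : ℂ} (hν : AccPt ν (Filter.principal S))
    {O : Set C(ℂ, ℂ)} (hO : IsOpen O) {f : C(ℂ, ℂ)} (hf : Differentiable ℂ f) (hfO : f ∈ O) :
    ∃ (s : Finset ℂ) (b : s → ℂ), ↑s ⊆ S ∧ ∑ w : s, b w • expMap w ∈ O := by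
  have hcl : f ∈ closure (Submodule.span ℂ (expMap '' S) : Set C(ℂ, ℂ)) :=
    mem_closure_span_expMap hν hf
  obtain ⟨g, hgO, hg⟩ := mem_closure_iff.1 hcl O hO hfO
  obtain ⟨l, hl, rfl⟩ := (Finsupp.mem_span_image_iff_linearCombination ℂ).1 hg
  refine ⟨l.support, fun w => l w, (Finsupp.mem_supported ℂ l).1 hl, ?_⟩
  rw [Finsupp.linearCombination_apply, Finsupp.sum] at hgO
  rwa [Finset.sum_coe_sort l.support fun w => l w • expMap w]

/-! ### The convolution operator -/

lemma ExpType.norm_term_le {a : ℕ → ℂ} {M R : ℝ} (hM : 0 < M) (hR : 0 < R)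
    (ha : ∀ n : ℕ, ‖a n‖ ≤ M * R ^ n / n.factorial) {h : ℂ → ℂ} (hh : Differentiable ℂ h)
    {z : ℂ} {C : ℝ} (hC : ∀ w, dist w z ≤ 2 * R → ‖h w‖ ≤ C) (n : ℕ) :
    ‖a n * iteratedDeriv n h z‖ ≤ M * C * (1 / 2) ^ n := by
  have hd : ‖iteratedDeriv n h z‖ ≤ n.factorial * C / (2 * R) ^ n :=
    Complex.norm_iteratedDeriv_le_of_forall_mem_sphere_norm_le n (by positivity)
      hh.diffContOnCl fun w hw => hC w (Metric.mem_sphere.1 hw).le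
  have hC0 : 0 ≤ C := (norm_nonneg _).trans (hC z (by simp; positivity))
  rw [norm_mul]
  calc _ ≤ (M * R ^ n / n.factorial) * (n.factorial * C / (2 * R) ^ n) := by
        gcongr
        exact ha n
    _ = _ := by
        have : (n.factorial : ℝ) ≠ 0 := by exact_mod_cast n.factorial_ne_zero
        rw [mul_pow, one_div, inv_pow]
        field_simp

lemma exists_norm_le_closedBall {h : ℂ → ℂ} (hh : Continuous h) (z : ℂ) (r : ℝ) :
    ∃ C, ∀ w, dist w z ≤ r → ‖h w‖ ≤ C := by
  obtain ⟨C, hC⟩ := (isCompact_closedBall z r).exists_bound_of_continuousOn hh.continuousOn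
  exact ⟨C, fun w hw => hC w hw⟩

lemma ExpType.summable {a : ℕ → ℂ} (ha : ExpType a) {h : ℂ → ℂ} (hh : Differentiable ℂ h)
    (z : ℂ) : Summable fun n => a n * iteratedDeriv n h z := by
  obtain ⟨M, hM, R, hR, ha⟩ := ha
  obtain ⟨C, hC⟩ := exists_norm_le_closedBall hh.continuous z (2 * R)
  exact Summable.of_norm_bounded (summable_geometric_two.mul_left (M * C))
    (ExpType.norm_term_le hM hR ha hh hC)

lemma ExpType.exists_norm_tsum_le {a : ℕ → ℂ} (ha : ExpType a) :
    ∃ M > (0 : ℝ), ∃ R > (0 : ℝ), ∀ h : ℂ → ℂ, Differentiable ℂ h → ∀ (z : ℂ) (C : ℝ),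
      (∀ w, dist w z ≤ R → ‖h w‖ ≤ C) → ‖∑' n, a n * iteratedDeriv n h z‖ ≤ M * C := by
  obtain ⟨M, hM, R, hR, ha⟩ := ha
  refine ⟨M * 2, by positivity, 2 * R, by positivity, fun h hh z C hC => ?_⟩
  have := tsum_of_norm_bounded ((hasSum_geometric_two).mul_left (M * C))
    (ExpType.norm_term_le hM hR ha hh hC)
  linarith

/-- `T` is the convolution operator with symbol coefficients `a`. -/
def IsConvolution (a : ℕ → ℂ) (T : Entire → Entire) : Prop :=
  ∀ (f : Entire) (z : ℂ), (T f).1 z = ∑' n : ℕ, a n * iteratedDeriv n (⇑f.1) z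

lemma IsConvolution.map_sum {a : ℕ → ℂ} {T : Entire → Entire} (hT : IsConvolution a T)
    (ha : ExpType a) {ι : Type*} (s : Finset ι) (c : ι → ℂ) (g : ι → Entire) (f : Entire)
    (hf : f.1 = ∑ i ∈ s, c i • (g i).1) : (T f).1 = ∑ i ∈ s, c i • (T (g i)).1 := by
  ext z
  have hfun : (⇑f.1 : ℂ → ℂ) = fun z => ∑ i ∈ s, c i * (g i).1 z := by
    ext z
    rw [hf]
    simp
  have hterm : ∀ n, a n * iteratedDeriv n (⇑f.1) z =
      ∑ i ∈ s, c i * (a n * iteratedDeriv n (⇑(g i).1) z) := fun n => by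
    have hcd : ∀ i, ContDiffAt ℂ n (⇑(g i).1) z := fun i => (g i).2.contDiff.contDiffAt
    rw [hfun, iteratedDeriv_fun_sum fun i _ => contDiffAt_const.mul (hcd i), Finset.mul_sum]
    refine Finset.sum_congr rfl fun i _ => ?_
    rw [iteratedDeriv_const_mul_field]
    ring
  rw [hT, tsum_congr hterm, Summable.tsum_finsetSum fun i _ =>
    (ha.summable (g i).2 z).mul_left (c i)]
  simp only [ContinuousMap.sum_apply, ContinuousMap.smul_apply, smul_eq_mul, tsum_mul_left]
  exact Finset.sum_congr rfl fun i _ => by rw [hT]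

lemma IsConvolution.iterate_map_sum {a : ℕ → ℂ} {T : Entire → Entire} (hT : IsConvolution a T)
    (ha : ExpType a) {ι : Type*} (s : Finset ι) (c : ι → ℂ) (q : ℕ) (g : ι → Entire) (f : Entire)
    (hf : f.1 = ∑ i ∈ s, c i • (g i).1) : (T^[q] f).1 = ∑ i ∈ s, c i • (T^[q] (g i)).1 := by
  induction q generalizing g f with
  | zero => exact hf
  | succ q ih =>
    simp only [Function.iterate_succ, Function.comp_apply]
    exact ih _ _ (hT.map_sum ha s c g f hf)

lemma IsConvolution.continuous {a : ℕ → ℂ} {T : Entire → Entire} (hT : IsConvolution a T)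
    (ha : ExpType a) : Continuous T := by
  obtain ⟨M, hM, R, hR, hbound⟩ := ha.exists_norm_tsum_le
  rw [continuous_iff_continuousAt]
  intro f
  rw [ContinuousAt, tendsto_subtype_rng,
    ContinuousMap.tendsto_iff_forall_isCompact_tendstoUniformlyOn]
  intro K hK
  have hid : Filter.Tendsto (fun g : Entire => g.1) (nhds f) (nhds f.1) :=
    continuous_subtype_val.tendsto f
  rw [ContinuousMap.tendsto_iff_forall_isCompact_tendstoUniformlyOn] at hid
  have hid' := hid _ (hK.cthickening (r := R))
  rw [Metric.tendstoUniformlyOn_iff] at hid' ⊢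
  intro ε hε
  filter_upwards [hid' (ε / (2 * M)) (by positivity)] with g hg z hz
  have hdiff : (T f).1 z - (T g).1 z =
      ∑' n, a n * iteratedDeriv n (⇑f.1 - ⇑g.1) z := by
    rw [hT, hT, ← (ha.summable f.2 z).tsum_sub (ha.summable g.2 z)]
    refine tsum_congr fun n => ?_
    rw [iteratedDeriv_sub f.2.contDiff.contDiffAt g.2.contDiff.contDiffAt]
    ring
  rw [dist_eq_norm, hdiff]
  refine (hbound _ (f.2.sub g.2) z (ε / (2 * M)) fun w hw => ?_).trans_lt ?_
  · rw [Pi.sub_apply, ← dist_eq_norm]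
    exact (hg w (Metric.mem_cthickening_of_dist_le w z R K hz hw)).le
  · field_simp
    linarith

/-- The exponential `z ↦ exp (ν * z)` as an entire function. -/
def expEntire (ν : ℂ) : Entire := ⟨expMap ν, differentiable_expMap ν⟩

lemma IsConvolution.map_exp {a : ℕ → ℂ} {T : Entire → Entire} (hT : IsConvolution a T)
    {Φ : ℂ → ℂ} (hrep : ∀ z : ℂ, HasSum (fun n : ℕ => a n * z ^ n) (Φ z)) (ν : ℂ) :
    (T (expEntire ν)).1 = Φ ν • expMap ν := by
  ext z
  have hterm : ∀ n, a n * iteratedDeriv n (⇑(expEntire ν).1) z =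
      a n * ν ^ n * Complex.exp (ν * z) := fun n => by
    change a n * iteratedDeriv n (fun w => Complex.exp (ν * w)) z = _
    rw [iteratedDeriv_cexp_const_mul]
    ring
  rw [hT, tsum_congr hterm, tsum_mul_right, (hrep ν).tsum_eq]
  rfl

lemma IsConvolution.iterate_exp {a : ℕ → ℂ} {T : Entire → Entire} (hT : IsConvolution a T)
    (ha : ExpType a) {Φ : ℂ → ℂ} (hrep : ∀ z : ℂ, HasSum (fun n : ℕ => a n * z ^ n) (Φ z))
    (ν : ℂ) (q : ℕ) : (T^[q] (expEntire ν)).1 = Φ ν ^ q • expMap ν := by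
  induction q with
  | zero => simp [expEntire]
  | succ q ih =>
    have := hT.iterate_map_sum ha {()} (fun _ => Φ ν) q (fun _ => expEntire ν) (T (expEntire ν))
      (by rw [hT.map_exp hrep]; simp [expEntire])
    rw [Function.iterate_succ_apply, this]
    simp [ih, smul_smul, pow_succ']

lemma IsConvolution.iterate_exp_sum {a : ℕ → ℂ} {T : Entire → Entire} (hT : IsConvolution a T)
    (ha : ExpType a) {Φ : ℂ → ℂ} (hrep : ∀ z : ℂ, HasSum (fun n : ℕ => a n * z ^ n) (Φ z))
    {ι : Type*} [Fintype ι] (c ν : ι → ℂ) (q : ℕ) (f : Entire)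
    (hf : f.1 = ∑ i, c i • expMap (ν i)) :
    (T^[q] f).1 = ∑ i, (c i * Φ (ν i) ^ q) • expMap (ν i) := by
  rw [hT.iterate_map_sum ha Finset.univ c q (fun i => expEntire (ν i)) f hf]
  simp only [hT.iterate_exp ha hrep, smul_smul]

/-! ### Frequencies of the powers of an exponential sum -/

lemma exists_radius {Φ : ℂ → ℂ} (hΦ : Differentiable ℂ Φ) {Γ : Set ℂ}
    (h : StrictlyConvexArc Γ) (hnt : Γ.Nontrivial) (hlev : ∀ z ∈ Γ, ‖Φ z‖ = 1)
    (hhull : convexHull ℝ (Γ ∪ {0}) \ (Γ ∪ {0}) ⊆ {z : ℂ | ‖Φ z‖ < 1})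
    {s : Finset ℂ} (hs : ↑s ⊆ innerArc Γ) (m : ℕ) :
    ∃ η > (0 : ℝ), ∀ (j : Fin (m + 1)) (κ : Fin j → Option s), (∃ i, κ i ≠ none) →
      ((j : ℕ) < m ∨ ∃ i k, κ i ≠ κ k) →
      ∀ z, dist z ((m : ℝ)⁻¹ • ∑ i, (κ i).elim 0 Subtype.val) < η → ‖Φ z‖ < 1 := by
  suffices hev : ∀ᶠ η in nhdsWithin (0 : ℝ) (Ioi 0), ∀ (j : Fin (m + 1)) (κ : Fin j → Option s),
      (∃ i, κ i ≠ none) → ((j : ℕ) < m ∨ ∃ i k, κ i ≠ κ k) →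
      ∀ z, dist z ((m : ℝ)⁻¹ • ∑ i, (κ i).elim 0 Subtype.val) < η → ‖Φ z‖ < 1 by
    obtain ⟨η, hη, hη0⟩ := (hev.and self_mem_nhdsWithin).exists
    exact ⟨η, hη0, hη⟩
  rw [Filter.eventually_all]
  intro j
  rw [Filter.eventually_all]
  intro κ
  by_cases h1 : ∃ i, κ i ≠ none
  swap
  · exact Filter.Eventually.of_forall fun _ h => absurd h h1
  by_cases h2 : (j : ℕ) < m ∨ ∃ i k, κ i ≠ κ k
  swap
  · exact Filter.Eventually.of_forall fun _ _ h => absurd h h2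
  have hlt : ‖Φ ((m : ℝ)⁻¹ • ∑ i, (κ i).elim 0 Subtype.val)‖ < 1 := by
    refine h.norm_average_lt_one hΦ hnt hlev hhull (Nat.lt_succ_iff.1 j.2) _ (fun i => ?_) ?_ ?_
    · rcases hκ : κ i with _ | w
      · exact Or.inl rfl
      · exact Or.inr (hs w.2)
    · obtain ⟨i, hi⟩ := h1
      obtain ⟨w, hw⟩ := Option.ne_none_iff_exists'.1 hi
      exact ⟨i, by rw [hw]; exact hs w.2⟩
    · rcases h2 with h2 | ⟨i, k, hik⟩
      · exact Or.inl h2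
      · right
        rcases hi : κ i with _ | w
        · exact Or.inl ⟨i, by rw [hi]; rfl⟩
        rcases hk : κ k with _ | w'
        · exact Or.inl ⟨k, by rw [hk]; rfl⟩
        refine Or.inr ⟨i, k, fun heq => hik ?_⟩
        rw [hi, hk] at heq ⊢
        exact congrArg some (Subtype.ext heq)
  obtain ⟨ε, hε, hball⟩ := Metric.isOpen_iff.1
    (isOpen_lt (hΦ.continuous.norm) (continuous_const (y := (1 : ℝ)))) _ hlt
  filter_upwards [Ioo_mem_nhdsGT hε] with η hη _ _ z hz
  exact hball (hz.trans hη.2)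

lemma norm_lt_one_of_tuple {Φ : ℂ → ℂ} {m : ℕ} (hm : 0 < m) {s t : Finset ℂ} {η : ℝ}
    (hη : ∀ (j : Fin (m + 1)) (κ : Fin j → Option s), (∃ i, κ i ≠ none) →
      ((j : ℕ) < m ∨ ∃ i k, κ i ≠ κ k) →
      ∀ z, dist z ((m : ℝ)⁻¹ • ∑ i, (κ i).elim 0 Subtype.val) < η → ‖Φ z‖ < 1)
    (hη0 : 0 < η) {γ : s → ℂ} (hγ : ∀ w : s, dist (γ w) w < η / 2) {p : ℂ}
    (hp : ∀ r : ℝ, 0 < r → r < 1 → ‖Φ (r • p)‖ < 1)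
    (ht : ∀ w ∈ t, ∃ r : ℝ, 0 < r ∧ r < 1 / (m + 1) ∧ w = r • p ∧ ‖w‖ < η / (2 * m))
    {j : ℕ} (hj0 : 0 < j) (hjm : j ≤ m) (τ : Fin j → t ⊕ s)
    (hτ : j < m ∨ ¬ ∃ w, τ = fun _ => Sum.inr w) :
    ‖Φ (∑ i, Sum.elim (Subtype.val : t → ℂ) (fun w => γ w / m) (τ i))‖ < 1 := by
  have hm' : (0 : ℝ) < m := by exact_mod_cast hm
  have hjm' : (j : ℝ) ≤ m := by exact_mod_cast hjm
  have hj' : (0 : ℝ) < j := by exact_mod_cast hj0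
  by_cases hall : ∀ i, ∃ w, τ i = Sum.inl w
  · choose w hw using hall
    choose r hr0 hr1 hrp _ using fun i => ht (w i) (w i).2
    have hsum : ∑ i, Sum.elim (Subtype.val : t → ℂ) (fun w => γ w / m) (τ i) =
        (∑ i, r i) • p := by
      rw [Finset.sum_smul]
      exact Finset.sum_congr rfl fun i _ => by rw [hw i, Sum.elim_inl, hrp i]
    rw [hsum]
    have hne : (Finset.univ : Finset (Fin j)).Nonempty := ⟨⟨0, hj0⟩, Finset.mem_univ _⟩
    refine hp _ (Finset.sum_pos (fun i _ => hr0 i) hne) ?_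
    calc ∑ i, r i < ∑ _i : Fin j, (1 / (m + 1) : ℝ) :=
          Finset.sum_lt_sum_of_nonempty hne fun i _ => hr1 i
      _ = j / (m + 1) := by simp [div_eq_mul_inv]
      _ ≤ 1 := by
        rw [div_le_one (by positivity)]
        linarith
  · push Not at hall
    obtain ⟨i₀, hi₀⟩ := hall
    refine hη ⟨j, Nat.lt_succ_of_le hjm⟩ (fun i => Sum.elim (fun _ => none) some (τ i))
      ⟨i₀, ?_⟩ ?_ _ ?_
    · rcases h : τ i₀ with w | w
      · exact absurd h (hi₀ w)
      · simp
    · refine hτ.imp id fun hτ => ?_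
      by_contra! hconst
      rcases h : τ i₀ with w | w
      · exact hi₀ w h
      refine hτ ⟨w, funext fun i => ?_⟩
      have := hconst i i₀
      rw [h] at this
      rcases h' : τ i with w' | w'
      · simp [h'] at this
      · simpa [h'] using this
    · rw [dist_eq_norm, Finset.smul_sum, ← Finset.sum_sub_distrib]
      have hterm : ∀ i ∈ (Finset.univ : Finset (Fin j)),
          ‖Sum.elim (Subtype.val : t → ℂ) (fun w => γ w / m) (τ i) -
            (m : ℝ)⁻¹ • (Sum.elim (fun _ => none) some (τ i) : Option s).elim 0 Subtype.val‖
            ≤ η / (2 * m) := by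
        intro i _
        rcases τ i with w | w
        · obtain ⟨_, _, _, _, h⟩ := ht w w.2
          simpa using h.le
        · have h := hγ w
          rw [dist_eq_norm] at h
          have heq : γ w / m - (m : ℝ)⁻¹ • (w : ℂ) = (γ w - w) / m := by
            rw [Complex.real_smul]
            push_cast
            ring
          simp only [Sum.elim_inr, Option.elim_some, heq, norm_div, Complex.norm_natCast]
          rw [div_le_div_iff₀ hm' (by positivity)]
          nlinarith
      refine (norm_sum_le_of_le _ hterm).trans_lt ?_
      rw [Finset.sum_const, Finset.card_univ, Fintype.card_fin, nsmul_eq_mul]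
      have : (j : ℝ) * (η / (2 * m)) ≤ m * (η / (2 * m)) := by gcongr
      refine this.trans_lt ?_
      field_simp
      linarith

lemma accPt_zero_segment {p : ℂ} (hp : p ≠ 0) {δ : ℝ} (hδ : 0 < δ) :
    AccPt (0 : ℂ) (Filter.principal {w | ∃ r : ℝ, 0 < r ∧ r < δ ∧ w = r • p}) := by
  rw [accPt_principal_iff_nhdsWithin]
  have hcont : Continuous fun r : ℝ => r • p := continuous_id.smul continuous_const
  have htend : Filter.Tendsto (fun r : ℝ => r • p) (nhdsWithin 0 (Ioi 0))
      (nhdsWithin 0 ({w | ∃ r : ℝ, 0 < r ∧ r < δ ∧ w = r • p} \ {0})) := by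
    refine tendsto_nhdsWithin_iff.2 ⟨?_, ?_⟩
    · have := hcont.tendsto 0
      rw [zero_smul] at this
      exact this.mono_left nhdsWithin_le_nhds
    · filter_upwards [Ioo_mem_nhdsGT hδ] with r hr
      exact ⟨⟨r, hr.1, hr.2, rfl⟩, smul_ne_zero hr.1.ne' hp⟩
  exact htend.neBot

/-- A finite exponential sum as an entire function. -/
def expSum {ι : Type*} [Fintype ι] (c ν : ι → ℂ) : Entire :=
  ⟨∑ i, c i • expMap (ν i), by
    have h : (⇑(∑ i, c i • expMap (ν i)) : ℂ → ℂ) = fun z => ∑ i, c i * expMap (ν i) z := by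
      ext z
      simp
    rw [h]
    exact Differentiable.fun_sum fun i _ => (differentiable_expMap (ν i)).const_mul (c i)⟩

lemma polyApply_X_pow (j : ℕ) (f : Entire) : (polyApply (X ^ j) f).1 = f.1 ^ j := by
  ext z
  simp [polyApply]

lemma IsConvolution.iterate_expSum_pow {a : ℕ → ℂ} {T : Entire → Entire}
    (hT : IsConvolution a T) (ha : ExpType a) {Φ : ℂ → ℂ}
    (hrep : ∀ z : ℂ, HasSum (fun n : ℕ => a n * z ^ n) (Φ z))
    {ι : Type*} [Fintype ι] (c ν : ι → ℂ) (q j : ℕ) :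
    (T^[q] (polyApply (X ^ j) (expSum c ν))).1 =
      ∑ τ : Fin j → ι, ((∏ i, c (τ i)) * Φ (∑ i, ν (τ i)) ^ q) • expMap (∑ i, ν (τ i)) := by
  refine hT.iterate_exp_sum ha hrep (fun τ : Fin j → ι => ∏ i, c (τ i)) (fun τ => ∑ i, ν (τ i))
    q _ ?_
  rw [polyApply_X_pow]
  classical
  change (∑ i, c i • expMap (ν i)) ^ j = _
  rw [Finset.sum_pow', Fintype.piFinset_univ]
  refine Finset.sum_congr rfl fun τ _ => ?_
  rw [← prod_expMap, Finset.prod_smul]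

lemma tendsto_coeff_zero {ι : Type*} {j : ℕ} {c ρ : ι → ℂ} (hρ : ∀ i, 1 ≤ ‖ρ i‖) {A : ℂ}
    (hA : ‖A‖ < 1) (τ : Fin j → ι) :
    Filter.Tendsto (fun q : ℕ => (∏ i, c (τ i) * (ρ (τ i))⁻¹ ^ q) * A ^ q) Filter.atTop
      (nhds 0) := by
  have heq : (fun q : ℕ => (∏ i, c (τ i) * (ρ (τ i))⁻¹ ^ q) * A ^ q) =
      fun q => (∏ i, c (τ i)) * ((∏ i, (ρ (τ i))⁻¹) * A) ^ q := by
    ext q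
    rw [Finset.prod_mul_distrib, Finset.prod_pow, mul_pow, mul_assoc]
  rw [heq, ← mul_zero (∏ i, c (τ i))]
  refine (tendsto_pow_atTop_nhds_zero_of_norm_lt_one ?_).const_mul _
  rw [norm_mul, norm_prod]
  have hprod : ∏ i, ‖(ρ (τ i))⁻¹‖ ≤ 1 :=
    Finset.prod_le_one (fun _ _ => norm_nonneg _) fun i _ => by
      rw [norm_inv]
      exact inv_le_one_of_one_le₀ (hρ _)
  exact (mul_le_of_le_one_left (norm_nonneg _) hprod).trans_lt hA

/-! ### Density and residuality -/

lemma exists_orbit_mem {Φ : ℂ → ℂ} (hΦ : Differentiable ℂ Φ) {a : ℕ → ℂ}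
    (hrep : ∀ z : ℂ, HasSum (fun n : ℕ => a n * z ^ n) (Φ z)) (ha : ExpType a)
    {Γ : Set ℂ} (h : StrictlyConvexArc Γ) (hnt : Γ.Nontrivial) (hlev : ∀ z ∈ Γ, ‖Φ z‖ = 1)
    (hhull : convexHull ℝ (Γ ∪ {0}) \ (Γ ∪ {0}) ⊆ {z : ℂ | ‖Φ z‖ < 1})
    {T : Entire → Entire} (hT : IsConvolution a T) {m : ℕ} (hm : 0 < m)
    {U V W : Set Entire} (hU : IsOpen U) (hV : IsOpen V) (hW : IsOpen W)
    (hUne : U.Nonempty) (hVne : V.Nonempty) (hW0 : 0 ∈ W) :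
    ∃ f ∈ U, ∃ q : ℕ, (∀ j ∈ Finset.Ico 1 m, T^[q] (polyApply (X ^ j) f) ∈ W) ∧
      T^[q] (polyApply (X ^ m) f) ∈ V := by
  obtain ⟨u, hu⟩ := hUne
  obtain ⟨v, hv⟩ := hVne
  obtain ⟨U', hU', rfl⟩ := isOpen_induced_iff.1 hU
  obtain ⟨V', hV', rfl⟩ := isOpen_induced_iff.1 hV
  have hm' : (0 : ℝ) < m := by exact_mod_cast hm
  have hK : Convex ℝ (convexHull ℝ (Γ ∪ {0})) := convex_convexHull ℝ _
  have hsub : Γ ∪ {0} ⊆ convexHull ℝ (Γ ∪ {0}) := subset_convexHull ℝ _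
  obtain ⟨p, hpS, hp0, hacc⟩ := h.exists_accPt hnt
  obtain ⟨s, b, hs, hbV⟩ := exists_exp_sum_mem hacc hV' v.2 hv
  obtain ⟨η, hη0, hη⟩ := exists_radius hΦ h hnt hlev hhull hs m
  -- move the frequencies on the arc to nearby points where the symbol is large
  obtain ⟨γ, ⟨hγV, hγη⟩, hγΦ⟩ : ∃ γ : s → ℂ, (∑ w : s, b w • expMap (γ w) ∈ V' ∧
      ∀ w : s, dist (γ w) w < η / 2) ∧ ∀ w, 1 < ‖Φ (γ w)‖ := by
    obtain ⟨w₀, hw₀⟩ := h.exists_hull_not_mem hnt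
    have hcl : (Subtype.val : s → ℂ) ∈ closure (univ.pi fun _ : s => {y | 1 < ‖Φ y‖}) := by
      rw [closure_pi_set]
      exact fun w _ => mem_closure_one_lt_norm hΦ (hhull hw₀) (hlev _ (hs w.2).1)
    have hopen : IsOpen {γ : s → ℂ | ∑ w : s, b w • expMap (γ w) ∈ V' ∧
        ∀ w : s, dist (γ w) w < η / 2} := by
      have hc : Continuous fun γ : s → ℂ => ∑ w : s, b w • expMap (γ w) :=
        continuous_finsetSum _ fun w _ =>
          (continuous_expMap.comp (continuous_apply w)).const_smul (b w)
      have h2 : IsOpen {γ : s → ℂ | ∀ w : s, dist (γ w) w < η / 2} := by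
        simp only [ofPred_forall]
        exact isOpen_iInter_of_finite fun w =>
          isOpen_lt ((continuous_apply w).dist continuous_const) continuous_const
      exact (hV'.preimage hc).inter h2
    obtain ⟨γ, hγ1, hγ2⟩ := mem_closure_iff.1 hcl _ hopen
      ⟨hbV, fun w => by rw [dist_self]; positivity⟩
    exact ⟨γ, hγ1, fun w => hγ2 w (mem_univ w)⟩
  -- approximate `u` with small frequencies on the segment from `0` to `p`
  obtain ⟨t, A, ht, hAU⟩ := exists_exp_sum_mem
    (accPt_zero_segment hp0 (δ := min (1 / (m + 1)) (η / (2 * m) / ‖p‖))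
      (lt_min (by positivity) (by positivity))) hU' u.2 hu
  have ht' : ∀ w ∈ t, ∃ r : ℝ, 0 < r ∧ r < 1 / (m + 1) ∧ w = r • p ∧ ‖w‖ < η / (2 * m) := by
    intro w hw
    obtain ⟨r, hr0, hr1, rfl⟩ := ht hw
    refine ⟨r, hr0, hr1.trans_le (min_le_left _ _), rfl, ?_⟩
    rw [norm_smul, Real.norm_of_nonneg hr0.le]
    exact (lt_div_iff₀ (norm_pos_iff.2 hp0)).1 (hr1.trans_le (min_le_right _ _))
  have hp : ∀ r : ℝ, 0 < r → r < 1 → ‖Φ (r • p)‖ < 1 := fun r hr0 hr1 =>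
    norm_lt_one_of_mem_interior hΦ h hnt hlev hhull
      (smul_mem_interior hK (hsub (Or.inr rfl)) (hsub (Or.inl hpS.1)) hpS.2 hr0 hr1)
  choose d hd using fun w : s => IsAlgClosed.exists_pow_nat_eq (Φ (γ w)) hm
  choose β hβ using fun w : s => IsAlgClosed.exists_pow_nat_eq (b w) hm
  have hd1 : ∀ w, 1 < ‖d w‖ := fun w => by
    by_contra! hle
    have := pow_le_one₀ (n := m) (norm_nonneg _) hle
    rw [← norm_pow, hd] at this
    exact (hγΦ w).not_ge this
  set c : t ⊕ s → ℂ := Sum.elim A β with hc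
  set ρ : t ⊕ s → ℂ := Sum.elim (fun _ => 1) d with hρ
  set ν : t ⊕ s → ℂ := Sum.elim Subtype.val (fun w => γ w / m) with hν
  have hρ1 : ∀ i, 1 ≤ ‖ρ i‖ := by
    rintro (w | w)
    · simp [hρ]
    · exact (hd1 w).le
  set F : ℕ → Entire := fun q => expSum (fun i => c i * (ρ i)⁻¹ ^ q) ν with hF
  have hFU : ∀ᶠ q in Filter.atTop, (F q).1 ∈ U' := by
    have hlim : Filter.Tendsto (fun q => (F q).1) Filter.atTop
        (nhds (∑ w : t, A w • expMap w + ∑ w : s, (0 : ℂ) • expMap (γ w / m))) := by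
      have hFq : (fun q => (F q).1) = fun q => ∑ w : t, A w • expMap w +
          ∑ w : s, (β w * (d w)⁻¹ ^ q) • expMap (γ w / m) := by
        ext1 q
        change ∑ i, _ = _
        rw [Fintype.sum_sum_type]
        simp [hc, hρ, hν]
      rw [hFq]
      refine tendsto_const_nhds.add (tendsto_finsetSum _ fun w _ => Filter.Tendsto.smul_const ?_ _)
      have hlt : ‖(d w)⁻¹‖ < 1 := by
        rw [norm_inv]
        exact inv_lt_one_of_one_lt₀ (hd1 w)
      simpa using (tendsto_pow_atTop_nhds_zero_of_norm_lt_one hlt).const_mul (β w)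
    refine hlim.eventually (hU'.mem_nhds ?_)
    have h0 : ∑ w : s, (0 : ℂ) • expMap (γ w / m) = 0 :=
      Finset.sum_eq_zero fun w _ => by ext z; simp
    rw [h0, add_zero]
    exact hAU
  have hterm : ∀ {j : ℕ}, 0 < j → j ≤ m → ∀ τ : Fin j → t ⊕ s,
      (j < m ∨ ¬ ∃ w, τ = fun _ => Sum.inr w) →
      Filter.Tendsto (fun q : ℕ => ((∏ i, c (τ i) * (ρ (τ i))⁻¹ ^ q) *
        Φ (∑ i, ν (τ i)) ^ q) • expMap (∑ i, ν (τ i))) Filter.atTop (nhds 0) := by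
    intro j hj0 hjm τ hτ
    rw [← zero_smul ℂ (expMap (∑ i, ν (τ i)))]
    exact (tendsto_coeff_zero hρ1
      (norm_lt_one_of_tuple hm hη hη0 hγη hp ht' hj0 hjm τ hτ) τ).smul_const _
  have hFW : ∀ᶠ q in Filter.atTop, ∀ j ∈ Finset.Ico 1 m, T^[q] (polyApply (X ^ j) (F q)) ∈ W := by
    rw [Filter.eventually_all_finset]
    intro j hj
    rw [Finset.mem_Ico] at hj
    have hlim : Filter.Tendsto (fun q => T^[q] (polyApply (X ^ j) (F q))) Filter.atTop
        (nhds 0) := by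
      rw [tendsto_subtype_rng]
      simp only [hF, hT.iterate_expSum_pow ha hrep]
      change Filter.Tendsto _ _ (nhds (0 : C(ℂ, ℂ)))
      rw [← Finset.sum_const_zero (s := (Finset.univ : Finset (Fin j → t ⊕ s)))]
      exact tendsto_finsetSum _ fun τ _ => hterm (by omega) hj.2.le τ (Or.inl hj.2)
    exact hlim.eventually (hW.mem_nhds hW0)
  have hFV : ∀ᶠ q in Filter.atTop, (T^[q] (polyApply (X ^ m) (F q))).1 ∈ V' := by
    classical
    set e : s → Fin m → t ⊕ s := fun w _ => Sum.inr w with he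
    have heinj : Function.Injective e := fun w w' hww =>
      Sum.inr_injective (congrFun hww ⟨0, hm⟩)
    set L : (Fin m → t ⊕ s) → C(ℂ, ℂ) := Function.extend e (fun w => b w • expMap (γ w)) 0
    have hL : ∑ τ, L τ = ∑ w, b w • expMap (γ w) :=
      (Fintype.sum_of_injective e heinj _ L
        (fun τ hτ => Function.extend_apply' _ _ τ hτ)
        (fun w => (heinj.extend_apply _ _ w).symm)).symm
    have hlim : Filter.Tendsto (fun q => (T^[q] (polyApply (X ^ m) (F q))).1) Filter.atTop
        (nhds (∑ τ, L τ)) := by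
      simp only [hF, hT.iterate_expSum_pow ha hrep]
      refine tendsto_finsetSum _ fun τ _ => ?_
      by_cases hτ : ∃ w, e w = τ
      · obtain ⟨w, rfl⟩ := hτ
        have hsum : ∑ i, ν (e w i) = γ w := by
          have : (m : ℂ) ≠ 0 := by exact_mod_cast hm.ne'
          simp [he, hν]
          field_simp
        have hcoeff : ∀ q : ℕ, (∏ i, c (e w i) * (ρ (e w i))⁻¹ ^ q) *
            Φ (∑ i, ν (e w i)) ^ q = b w := fun q => by
          have hΦ0 : Φ (γ w) ≠ 0 := norm_pos_iff.1 (one_pos.trans (hγΦ w))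
          rw [hsum]
          simp only [he, hc, hρ, Sum.elim_inr, Finset.prod_const, Finset.card_univ,
            Fintype.card_fin]
          rw [mul_pow, hβ, ← pow_mul, mul_comm q m, pow_mul, inv_pow, hd, inv_pow, mul_assoc,
            inv_mul_cancel₀ (pow_ne_zero _ hΦ0), mul_one]
        rw [show L (e w) = b w • expMap (γ w) from heinj.extend_apply _ _ w]
        exact tendsto_const_nhds.congr fun q => by rw [hcoeff, hsum]
      · rw [show L τ = 0 from Function.extend_apply' _ _ τ hτ]
        exact hterm hm le_rfl τ (Or.inr fun ⟨w, hw⟩ => hτ ⟨w, hw.symm⟩)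
    rw [hL] at hlim
    exact hlim.eventually (hV'.mem_nhds hγV)
  obtain ⟨q, h1, h2, h3⟩ := (hFU.and (hFW.and hFV)).exists
  exact ⟨F q, h1, q, h2, h3⟩

lemma continuous_polyApply (P : Polynomial ℂ) : Continuous (polyApply P) := by
  refine continuous_induced_rng.2 ?_
  have h : (Subtype.val ∘ polyApply P : Entire → C(ℂ, ℂ)) = fun f => P.aeval f.1 := by
    ext f z
    have : (P.aeval f.1) z = P.aeval (f.1 z) := by
      induction P using Polynomial.induction_on' with
      | add p q hp hq => simp [hp, hq]
      | monomial n c => simp [Polynomial.aeval_monomial, Algebra.algebraMap_eq_smul_one]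
    rw [this]
    simp [polyApply, Polynomial.coe_aeval_eq_eval]
  rw [h]
  exact P.continuous_aeval.comp continuous_subtype_val

lemma polyApply_eq_sum (P : Polynomial ℂ) (f : Entire) :
    (polyApply P f).1 =
      ∑ i : Fin (P.natDegree + 1), P.coeff i • (polyApply (X ^ (i : ℕ)) f).1 := by
  ext z
  simp [polyApply, Polynomial.eval_eq_sum_range, Finset.sum_range]

/-- The functions with a common iterate sending their powers of order less than `m` to `W` and
their `m`-th power to `V`. -/
def powerHitting (T : Entire → Entire) (m : ℕ) (V W : Set Entire) : Set Entire :=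
  {f | ∃ q : ℕ, (∀ j ∈ Finset.Ico 1 m, T^[q] (polyApply (X ^ j) f) ∈ W) ∧
    T^[q] (polyApply (X ^ m) f) ∈ V}

lemma isOpen_powerHitting {T : Entire → Entire} (hT : Continuous T) (m : ℕ) {V W : Set Entire}
    (hV : IsOpen V) (hW : IsOpen W) : IsOpen (powerHitting T m V W) := by
  have hc : ∀ q j : ℕ, Continuous fun f => T^[q] (polyApply (X ^ j) f) := fun q j =>
    (hT.iterate q).comp (continuous_polyApply _)
  simp only [powerHitting, ofPred_exists, ofPred_and]
  refine isOpen_iUnion fun q => IsOpen.inter ?_ (hV.preimage (hc q m))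
  simp only [ofPred_forall]
  exact isOpen_biInter_finset fun j _ => hW.preimage (hc q j)

lemma hypercyclic_polyApply {a : ℕ → ℂ} (ha : ExpType a) {T : Entire → Entire}
    (hT : IsConvolution a T) {f : Entire}
    (hf : ∀ m, 0 < m → ∀ V W : Set Entire, IsOpen V → IsOpen W → V.Nonempty → 0 ∈ W →
      f ∈ powerHitting T m V W)
    {P : Polynomial ℂ} (hP0 : P.coeff 0 = 0) (hP : P ≠ 0) : Hypercyclic T (polyApply P f) := by
  have hlead : P.coeff P.natDegree ≠ 0 := Polynomial.leadingCoeff_ne_zero.2 hP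
  have hm : 0 < P.natDegree := Nat.pos_of_ne_zero fun h0 => hlead (h0 ▸ hP0)
  refine dense_iff_inter_open.2 fun O hO ⟨g, hg⟩ => ?_
  obtain ⟨O', hO', rfl⟩ := isOpen_induced_iff.1 hO
  set m := P.natDegree with hmdef
  have hΨ : Continuous fun x : Fin (m + 1) → C(ℂ, ℂ) => ∑ i : Fin (m + 1), P.coeff i • x i :=
    continuous_finsetSum _ fun i _ => (continuous_apply i).const_smul (P.coeff i)
  set x₀ : Fin (m + 1) → C(ℂ, ℂ) := Pi.single (Fin.last m) ((P.coeff m)⁻¹ • g.1) with hx₀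
  have hx₀O : ∑ i : Fin (m + 1), P.coeff i • x₀ i ∈ O' := by
    have : ∑ i : Fin (m + 1), P.coeff i • x₀ i = g.1 := by
      ext z
      rw [Fin.sum_univ_castSucc]
      simp [hx₀, hlead, Fin.castSucc_ne_last]
    rwa [this]
  obtain ⟨u, hu, huO⟩ := isOpen_pi_iff'.1 (hO'.preimage hΨ) x₀ hx₀O
  have hmem := hf m hm (Subtype.val ⁻¹' u (Fin.last m))
    (Subtype.val ⁻¹' ⋂ i : Fin m, u i.castSucc)
    ((hu _).1.preimage continuous_subtype_val)
    ((isOpen_iInter_of_finite fun i => (hu _).1).preimage continuous_subtype_val)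
    ⟨⟨(P.coeff m)⁻¹ • g.1, g.2.const_smul _⟩, by
      have := (hu (Fin.last m)).2
      rwa [hx₀, Pi.single_eq_same] at this⟩
    (mem_iInter.2 fun i => by
      have := (hu i.castSucc).2
      rwa [hx₀, Pi.single_eq_of_ne (Fin.castSucc_ne_last i)] at this)
  obtain ⟨q, hqW, hqV⟩ := hmem
  refine ⟨_, ?_, ⟨q, rfl⟩⟩
  set x : Fin (m + 1) → C(ℂ, ℂ) := fun i =>
    if (i : ℕ) = 0 then 0 else (T^[q] (polyApply (X ^ (i : ℕ)) f)).1 with hx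
  have hxu : x ∈ univ.pi u := by
    intro i _
    refine Fin.lastCases ?_ (fun i => ?_) i
    · simpa [hx, hm.ne'] using hqV
    · by_cases hi : (i : ℕ) = 0
      · have := (hu i.castSucc).2
        rw [hx₀, Pi.single_eq_of_ne (Fin.castSucc_ne_last i)] at this
        simpa only [hx, Fin.val_castSucc, hi, if_true] using this
      · have := mem_iInter.1 (hqW i (Finset.mem_Ico.2 ⟨Nat.pos_of_ne_zero hi, i.2⟩)) i
        simpa only [hx, Fin.val_castSucc, hi, if_false] using this
  have hsum : (T^[q] (polyApply P f)).1 = ∑ i : Fin (m + 1), P.coeff i • x i := by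
    rw [hT.iterate_map_sum ha Finset.univ (fun i : Fin (m + 1) => P.coeff i) q
      (fun i => polyApply (X ^ (i : ℕ)) f) _ (polyApply_eq_sum P f)]
    refine Finset.sum_congr rfl fun i _ => ?_
    by_cases hi : (i : ℕ) = 0
    · ext z
      simp [hi, hP0]
    · simp only [hx, hi, if_false]
  change (T^[q] (polyApply P f)).1 ∈ O'
  rw [hsum]
  exact huO hxu
instance : SecondCountableTopology Entire :=
  TopologicalSpace.secondCountableTopology_induced _ _ Subtype.val

/-- If an entire function `Φ` of exponential type has a level set
`{z | |Φ z| = 1}` containing a non-trivial strictly convex compact arc `Γ₁` with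
`conv(Γ₁ ∪ {0}) \ (Γ₁ ∪ {0}) ⊆ Φ⁻¹(𝔻)`, then the set of entire functions generating a
hypercyclic algebra for the convolution operator `Φ(D)` is residual in `H(ℂ)`. -/
theorem stmt0 (Φ : ℂ → ℂ) (hΦ : Differentiable ℂ Φ) (a : ℕ → ℂ)
    (hrep : ∀ z : ℂ, HasSum (fun n : ℕ => a n * z ^ n) (Φ z))
    (htype : ExpType a)
    (Γ₁ : Set ℂ) (harc : StrictlyConvexArc Γ₁) (hnt : Γ₁.Nontrivial)
    (hlev : ∀ z ∈ Γ₁, ‖Φ z‖ = 1)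
    (hhull : convexHull ℝ (Γ₁ ∪ {0}) \ (Γ₁ ∪ {0}) ⊆ {z : ℂ | ‖Φ z‖ < 1})
    (T : Entire → Entire)
    (hT : ∀ (f : Entire) (z : ℂ), (T f).1 z = ∑' n : ℕ, a n * iteratedDeriv n (⇑f.1) z) :
    { f : Entire | f ≠ 0 ∧ GeneratesHCAlgebra T f } ∈ residual Entire := by
  have hconv : IsConvolution a T := hT
  have hTc : Continuous T := hconv.continuous htype
  have hres : ∀ᶠ f in residual Entire, ∀ m : ℕ,
      ∀ V ∈ TopologicalSpace.countableBasis Entire,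
      ∀ W ∈ TopologicalSpace.countableBasis Entire, 0 < m → 0 ∈ W →
        f ∈ powerHitting T m V W := by
    rw [eventually_countable_forall]
    intro m
    rw [eventually_countable_ball (TopologicalSpace.countable_countableBasis Entire)]
    intro V hV
    rw [eventually_countable_ball (TopologicalSpace.countable_countableBasis Entire)]
    intro W hW
    by_cases hmW : 0 < m ∧ (0 : Entire) ∈ W
    swap
    · exact Filter.Eventually.of_forall fun f h1 h2 => absurd ⟨h1, h2⟩ hmW
    have hVo := TopologicalSpace.isOpen_of_mem_countableBasis hV
    have hWo := TopologicalSpace.isOpen_of_mem_countableBasis hW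
    have hdense : Dense (powerHitting T m V W) := dense_iff_inter_open.2 fun U hU hUne => by
      obtain ⟨f, hf, hf'⟩ := exists_orbit_mem hΦ hrep htype harc hnt hlev hhull hconv hmW.1 hU hVo
        hWo hUne (TopologicalSpace.nonempty_of_mem_countableBasis hV) hmW.2
      exact ⟨f, hf, hf'⟩
    filter_upwards [residual_of_dense_open (isOpen_powerHitting hTc m hVo hWo) hdense] with f hf _ _
    exact hf
  filter_upwards [hres] with f hf
  have hf' : ∀ m, 0 < m → ∀ V W : Set Entire, IsOpen V → IsOpen W → V.Nonempty → 0 ∈ W →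
      f ∈ powerHitting T m V W := by
    intro m hm V W hV hW ⟨v, hv⟩ hW0
    have hbasis := TopologicalSpace.isBasis_countableBasis Entire
    obtain ⟨V', hV', -, hVV⟩ := hbasis.exists_subset_of_mem_open hv hV
    obtain ⟨W', hW', hW0', hWW⟩ := hbasis.exists_subset_of_mem_open hW0 hW
    obtain ⟨q, hq1, hq2⟩ := hf m V' hV' W' hW' hm hW0'
    exact ⟨q, fun j hj => hWW (hq1 j hj), hVV hq2⟩
  refine ⟨?_, fun P hP0 hP => ?_⟩
  · rintro rfl
    have hone : expEntire 0 ≠ 0 := fun h => by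
      have : (expEntire 0).1 0 = (0 : Entire).1 0 := by rw [h]
      exact one_ne_zero ((by simp [expEntire, expMap_apply] : (expEntire 0).1 0 = 1).symm.trans this)
    obtain ⟨q, -, hq⟩ := hf' 1 one_pos {0}ᶜ univ isOpen_compl_singleton isOpen_univ
      ⟨_, hone⟩ (mem_univ _)
    refine hq (Subtype.ext ?_)
    have hz : (polyApply (X ^ 1) 0).1 = 0 := by
      rw [polyApply_X_pow, pow_one]
      rfl
    rw [hconv.iterate_map_sum htype (∅ : Finset ℕ) (fun _ => 0) q (fun _ => 0) _
      (by rw [hz, Finset.sum_empty]), Finset.sum_empty]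
    rfl
  · refine hypercyclic_polyApply htype hconv hf' hP0 fun h => hP ?_
    rw [h]
    apply Subtype.ext
    ext z
    simp only [polyApply, Polynomial.eval_zero]
    rfl
end
end

section
/- Let Φ : ℂ → ℂ be entire of exponential type, let a ∈ ℂ with a ≠ 0, let φ : ℂ → ℂ be the homothety φ(z) = a·z, and set Φ_a = Φ ∘ φ and C_φ(f) = f ∘ φ for f ∈ H(ℂ). Then Φ_a is an entire function of exponential type, and C_φ maps the set of hypercyclic vectors of the convolution operator Φ_a(D) bijectively onto the set of hypercyclic vectors of Φ(D); that is, for every entire f, f is hypercyclic for Φ_a(D) if and only if f ∘ φ is hypercyclic for Φ(D). -/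
open Set Polynomial

noncomputable section

theorem hypercyclic_iff_of_semiconj {X Y : Type*} [TopologicalSpace X] [TopologicalSpace Y]
    (h : X ≃ₜ Y) {S : X → X} {T : Y → Y} (hST : Function.Semiconj h S T) (x : X) :
    Hypercyclic S x ↔ Hypercyclic T (h x) := by
  have hrange : (Set.range fun n : ℕ => T^[n] (h x)) = h '' Set.range fun n : ℕ => S^[n] x := by
    rw [← Set.range_comp]
    congr 1
    funext n
    exact ((hST.iterate_right n) x).symm
  unfold Hypercyclic
  rw [hrange]
  exact h.isDenseEmbedding.dense_image.symm

/-- Composition of an entire function with the homothety `z ↦ a * z`. -/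
def compHomothety (a : ℂ) (f : Entire) : Entire :=
  ⟨⟨fun z => f.1 (a * z), (f.2.comp (differentiable_id.const_mul a)).continuous⟩,
    f.2.comp (differentiable_id.const_mul a)⟩

theorem continuous_compHomothety (a : ℂ) : Continuous (compHomothety a) :=
  Continuous.subtype_mk
    ((ContinuousMap.continuous_precomp (⟨fun z => a * z, by fun_prop⟩ : C(ℂ, ℂ))).comp
      continuous_subtype_val) _

/-- Composition with a nonconstant homothety is a homeomorphism of the space of entire
functions. -/
def compHomothetyHomeomorph (a : ℂ) (ha : a ≠ 0) : Entire ≃ₜ Entire where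
  toFun := compHomothety a
  invFun := compHomothety a⁻¹
  left_inv f := Subtype.ext <| ContinuousMap.ext fun z => by
    simp [compHomothety, mul_inv_cancel_left₀ ha]
  right_inv f := Subtype.ext <| ContinuousMap.ext fun z => by
    simp [compHomothety, inv_mul_cancel_left₀ ha]
  continuous_toFun := continuous_compHomothety a
  continuous_invFun := continuous_compHomothety a⁻¹

theorem ExpType.mul_pow {c : ℕ → ℂ} (hc : ExpType c) {a : ℂ} (ha : a ≠ 0) :
    ExpType fun n => c n * a ^ n := by
  obtain ⟨M, hM, R, hR, h⟩ := hc
  refine ⟨M, hM, R * ‖a‖, mul_pos hR (norm_pos_iff.mpr ha), fun n => ?_⟩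
  rw [norm_mul, norm_pow, _root_.mul_pow, ← mul_assoc, mul_div_right_comm]
  exact mul_le_mul_of_nonneg_right (h n) (by positivity)

/-- For `Φ` entire of exponential type and `φ(z) = a z` with `a ≠ 0`,
`Φ_a = Φ ∘ φ` is entire of exponential type and `C_φ` maps `HC(Φ_a(D))` bijectively onto
`HC(Φ(D))`: `f` is hypercyclic for `Φ_a(D)` iff `f ∘ φ` is hypercyclic for `Φ(D)`. -/
theorem stmt1 (Φ : ℂ → ℂ) (hΦ : Differentiable ℂ Φ) (c : ℕ → ℂ)
    (hrep : ∀ z : ℂ, HasSum (fun n : ℕ => c n * z ^ n) (Φ z))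
    (htype : ExpType c)
    (a : ℂ) (ha : a ≠ 0)
    (T S : Entire → Entire)
    (hT : ∀ (f : Entire) (z : ℂ), (T f).1 z = ∑' n : ℕ, c n * iteratedDeriv n (⇑f.1) z)
    (hS : ∀ (f : Entire) (z : ℂ),
      (S f).1 z = ∑' n : ℕ, (c n * a ^ n) * iteratedDeriv n (⇑f.1) z) :
    Differentiable ℂ (fun z : ℂ => Φ (a * z)) ∧
    (∀ z : ℂ, HasSum (fun n : ℕ => (c n * a ^ n) * z ^ n) (Φ (a * z))) ∧
    ExpType (fun n : ℕ => c n * a ^ n) ∧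
    ∀ f : Entire, Hypercyclic S f ↔ Hypercyclic T
      ⟨⟨fun z => f.1 (a * z), by exact (f.2.comp (differentiable_id.const_mul a)).continuous⟩,
        by exact f.2.comp (differentiable_id.const_mul a)⟩ := by
  refine ⟨hΦ.comp (differentiable_id.const_mul a), fun z => ?_, htype.mul_pow ha, fun f => ?_⟩
  · simpa only [_root_.mul_pow, mul_assoc] using hrep (a * z)
  · refine hypercyclic_iff_of_semiconj (compHomothetyHomeomorph a ha) (fun g => ?_) f
    refine Subtype.ext <| ContinuousMap.ext fun z => ?_
    refine (hS g (a * z)).trans (Eq.trans ?_ (hT (compHomothety a g) z).symm)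
    refine tsum_congr fun n => ?_
    have hderiv : iteratedDeriv n (⇑(compHomothety a g).1) z
        = a ^ n * iteratedDeriv n (⇑g.1) (a * z) :=
      congrFun (iteratedDeriv_comp_const_mul g.2.contDiff a) z
    rw [hderiv, mul_assoc]
end
end
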